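/- arXiv:2511.00888 — 5 statements merged into one kernel-verified Lean document; each statement's English description precedes it below -/
import Mathlib

section
/- In the logic BIAT, for any two distinct agents i and j and any atomic proposition p, the formula Help_{i→j}p ∧ ¬E_i p ∧ ¬E_j p is consistent; that is, its negation ¬(E_i(A_jp → p) ∧ A_jp ∧ ¬E_i p ∧ ¬E_j p) is not provable in ⊢_BIAT. -/
/- The language of BIAT: classical propositional logic extended with
   modalities `E i` ("agent i brings about") and `A i` ("agent i attempts"). -/
inductive BForm (Agt Atm : Type) : Type
  | atom : Atm → BForm Agt Atm
  | top  : BForm Agt Atm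
  | neg  : BForm Agt Atm → BForm Agt Atm
  | and  : BForm Agt Atm → BForm Agt Atm → BForm Agt Atm
  | E    : Agt → BForm Agt Atm → BForm Agt Atm
  | A    : Agt → BForm Agt Atm → BForm Agt Atm

namespace BForm

variable {Agt Atm : Type}

def imp (φ ψ : BForm Agt Atm) : BForm Agt Atm := neg (and φ (neg ψ))

def iff (φ ψ : BForm Agt Atm) : BForm Agt Atm := and (imp φ ψ) (imp ψ φ)

end BForm

/- A formula is a classical propositional tautology when it is true under every
   valuation of formulas that respects ⊤, ¬ and ∧ (modal subformulas are
   treated as atoms). -/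
def BTaut {Agt Atm : Type} (φ : BForm Agt Atm) : Prop :=
  ∀ v : BForm Agt Atm → Prop,
    v BForm.top →
    (∀ ψ, v (BForm.neg ψ) ↔ ¬ v ψ) →
    (∀ ψ χ, v (BForm.and ψ χ) ↔ (v ψ ∧ v χ)) →
    v φ

/- The proof system ⊢_BIAT. -/
inductive BIAT {Agt Atm : Type} : BForm Agt Atm → Prop
  | taut {φ} : BTaut φ → BIAT φ
  | notaut (i : Agt) : BIAT (BForm.neg (BForm.E i BForm.top))
  | success (i : Agt) (φ : BForm Agt Atm) : BIAT ((BForm.E i φ).imp φ)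
  | mp {φ ψ} : BIAT (φ.imp ψ) → BIAT φ → BIAT ψ
  | ree (i : Agt) {φ ψ} : BIAT (φ.iff ψ) →
      BIAT ((BForm.E i φ).iff (BForm.E i ψ))
  | rea (i : Agt) {φ ψ} : BIAT (φ.iff ψ) →
      BIAT ((BForm.A i φ).iff (BForm.A i ψ))

/- Successful assistance: Help_{i→j}φ := E_i(A_jφ → φ) ∧ A_jφ. -/
def BHelp {Agt Atm : Type} (i j : Agt) (φ : BForm Agt Atm) : BForm Agt Atm :=
  (BForm.E i ((BForm.A j φ).imp φ)).and (BForm.A j φ)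

/-- Truth of a formula in a three-world neighbourhood model: atoms hold exactly at world `0`,
attempts succeed everywhere but at world `2`, and at world `0` every agent brings about exactly
the proposition `{0, 2}`. -/
def BForm.Holds {Agt Atm : Type} : BForm Agt Atm → Fin 3 → Prop
  | .atom _, w => w = 0
  | .top, _ => True
  | .neg φ, w => ¬ φ.Holds w
  | .and φ ψ, w => φ.Holds w ∧ ψ.Holds w
  | .E _ φ, w => w = 0 ∧ φ.Holds 0 ∧ ¬ φ.Holds 1 ∧ φ.Holds 2
  | .A _ _, w => w ≠ 2

theorem BForm.holds_imp {Agt Atm : Type} (φ ψ : BForm Agt Atm) (w : Fin 3) :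
    (φ.imp ψ).Holds w ↔ (φ.Holds w → ψ.Holds w) := by
  simp [BForm.imp, BForm.Holds]

theorem BForm.holds_iff {Agt Atm : Type} (φ ψ : BForm Agt Atm) (w : Fin 3) :
    (φ.iff ψ).Holds w ↔ (φ.Holds w ↔ ψ.Holds w) := by
  simp only [BForm.iff, BForm.Holds, BForm.holds_imp, iff_iff_implies_and_implies]

theorem BIAT.holds {Agt Atm : Type} {φ : BForm Agt Atm} (h : BIAT φ) (w : Fin 3) :
    φ.Holds w := by
  induction h generalizing w with
  | taut h =>
    exact h (fun ψ => ψ.Holds w) trivial (fun _ => Iff.rfl) (fun _ _ => Iff.rfl)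
  | notaut i => simp [BForm.Holds]
  | success i φ =>
    rw [BForm.holds_imp]
    rintro ⟨rfl, h, -⟩
    exact h
  | mp _ _ ih₁ ih₂ => exact (BForm.holds_imp _ _ w).1 (ih₁ w) (ih₂ w)
  | ree i _ ih =>
    simp only [BForm.holds_iff] at ih
    simp only [BForm.holds_iff, BForm.Holds, ih]
  | rea i _ _ => simp only [BForm.holds_iff, BForm.Holds]

/-- For distinct agents i, j and any atomic proposition p, the
    formula Help_{i→j}p ∧ ¬E_i p ∧ ¬E_j p is consistent in BIAT: its negation
    is not provable. -/
theorem biat_help_consistent {Agt Atm : Type} [Fintype Agt] [Countable Atm]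
    (i j : Agt) (hij : i ≠ j) (p : Atm) :
    ¬ BIAT (BForm.neg
      ((BHelp i j (BForm.atom p)).and
        ((BForm.neg (BForm.E i (BForm.atom p))).and
          (BForm.neg (BForm.E j (BForm.atom p)))))) := by
  intro h
  have h₀ := h.holds 0
  simp [BHelp, BForm.imp, BForm.Holds] at h₀
end

section
/- For every class C of cohesion networks and every formula φ ∈ L, there exists a formula ψ ∈ L containing no occurrence of any Help modality and no occurrence of E_G or A_G for a nondegenerate group G (i.e., all coalition modalities occurring in ψ are of the form E_{i} or A_{i} for singleton coalitions) such that ⊢_C φ ↔ ψ. -/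
/- A coalition (group) is a nonempty finite set of agents. -/
abbrev Coal (Agt : Type) [DecidableEq Agt] := {s : Finset Agt // s.Nonempty}

/- A (candidate) cohesion network: a set Γ of coalitions together with an
   edge relation ⇒ between coalitions.  (Nonemptiness of the coalitions,
   i.e. ∅ ∉ Γ, is built into the type `Coal`.) -/
abbrev Net (Agt : Type) [DecidableEq Agt] :=
  Finset (Coal Agt) × Finset (Coal Agt × Coal Agt)

/- `Admissible G N` says that N = (Γ, ⇒) is a cohesion network for G:
   Γ ⊆ 𝒫(G), ⇒ ⊆ Γ × Γ, G ∉ Γ, ∅ ∉ Γ (automatic), and every member of G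
   occurs in some edge of ⇒. -/
def Admissible {Agt : Type} [DecidableEq Agt] (G : Finset Agt) (N : Net Agt) : Prop :=
  (∀ C ∈ N.1, C.1 ⊆ G ∧ C.1 ≠ G) ∧
  (∀ e ∈ N.2, e.1 ∈ N.1 ∧ e.2 ∈ N.1) ∧
  (∀ i ∈ G, ∃ e ∈ N.2, i ∈ e.1.1 ∪ e.2.1)

/- A class of cohesion networks assigns to every nondegenerate group G a set
   C(G) ⊆ C0(G) of admissible cohesion networks for G. -/
def CohClass {Agt : Type} [DecidableEq Agt] (C : Finset Agt → Finset (Net Agt)) : Prop :=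
  ∀ G : Finset Agt, 2 ≤ G.card → ∀ N ∈ C G, Admissible G N

/- The language L: atoms, ⊤, ¬, ∧, and modalities E_G, A_G, Help_{C1→C2}
   for nonempty coalitions. -/
inductive LForm (Agt Atm : Type) [DecidableEq Agt] : Type
  | atom : Atm → LForm Agt Atm
  | top  : LForm Agt Atm
  | neg  : LForm Agt Atm → LForm Agt Atm
  | and  : LForm Agt Atm → LForm Agt Atm → LForm Agt Atm
  | E    : Coal Agt → LForm Agt Atm → LForm Agt Atm
  | A    : Coal Agt → LForm Agt Atm → LForm Agt Atm
  | help : Coal Agt → Coal Agt → LForm Agt Atm → LForm Agt Atm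

namespace LForm

variable {Agt Atm : Type} [DecidableEq Agt]

def imp (φ ψ : LForm Agt Atm) : LForm Agt Atm := neg (and φ (neg ψ))

def iff (φ ψ : LForm Agt Atm) : LForm Agt Atm := and (imp φ ψ) (imp ψ φ)

def or (φ ψ : LForm Agt Atm) : LForm Agt Atm := neg (and (neg φ) (neg ψ))

def bot : LForm Agt Atm := neg top

def bigAnd (l : List (LForm Agt Atm)) : LForm Agt Atm := l.foldr and top

def bigOr (l : List (LForm Agt Atm)) : LForm Agt Atm := l.foldr or bot

end LForm

/- The singleton coalition {i}. -/
def single {Agt : Type} [DecidableEq Agt] (i : Agt) : Coal Agt :=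
  ⟨{i}, Finset.singleton_nonempty i⟩

/- Classical propositional tautologies over L: true under every valuation of
   formulas respecting ⊤, ¬ and ∧ (modal subformulas are treated as atoms). -/
def LTaut {Agt Atm : Type} [DecidableEq Agt] (φ : LForm Agt Atm) : Prop :=
  ∀ v : LForm Agt Atm → Prop,
    v LForm.top →
    (∀ ψ, v (LForm.neg ψ) ↔ ¬ v ψ) →
    (∀ ψ χ, v (LForm.and ψ χ) ↔ (v ψ ∧ v χ)) →
    v φ

/- The proof system ⊢_C, for a class C of cohesion networks. -/
inductive CProv {Agt Atm : Type} [DecidableEq Agt]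
    (C : Finset Agt → Finset (Net Agt)) : LForm Agt Atm → Prop
  | taut {φ} : LTaut φ → CProv C φ
  | notaut (i : Agt) : CProv C (LForm.neg (LForm.E (single i) LForm.top))
  | success (i : Agt) (φ : LForm Agt Atm) : CProv C ((LForm.E (single i) φ).imp φ)
  | help_ax (C1 C2 : Coal Agt) (φ : LForm Agt Atm) :
      CProv C ((LForm.help C1 C2 φ).iff
        ((LForm.E C1 ((LForm.A C2 φ).imp φ)).and (LForm.A C2 φ)))
  | cohagen (G : Coal Agt) (hG : 2 ≤ G.1.card) (φ : LForm Agt Atm) :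
      CProv C ((LForm.E G φ).iff
        (LForm.bigOr ((C G.1).toList.map (fun N =>
          LForm.bigAnd (N.2.toList.map (fun e => LForm.help e.1 e.2 φ))))))
  | attind (G : Coal Agt) (hG : 2 ≤ G.1.card) (φ : LForm Agt Atm) :
      CProv C ((LForm.A G φ).iff
        (LForm.bigAnd (G.1.toList.map (fun i => LForm.A (single i) φ))))
  | mp {φ ψ} : CProv C (φ.imp ψ) → CProv C φ → CProv C ψ
  | ree (i : Agt) {φ ψ} : CProv C (φ.iff ψ) →
      CProv C ((LForm.E (single i) φ).iff (LForm.E (single i) ψ))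
  | rea (i : Agt) {φ ψ} : CProv C (φ.iff ψ) →
      CProv C ((LForm.A (single i) φ).iff (LForm.A (single i) ψ))

/- A formula is reduced when it contains no Help modality and all its
   coalition modalities are indexed by singleton coalitions. -/
def Reduced {Agt Atm : Type} [DecidableEq Agt] : LForm Agt Atm → Prop
  | .atom _ => True
  | .top => True
  | .neg φ => Reduced φ
  | .and φ ψ => Reduced φ ∧ Reduced ψ
  | .E G φ => (∃ i : Agt, G = single i) ∧ Reduced φ
  | .A G φ => (∃ i : Agt, G = single i) ∧ Reduced φ
  | .help _ _ _ => False

section Reduction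

variable {Agt Atm : Type} [DecidableEq Agt] {C : Finset Agt → Finset (Net Agt)}

theorem LTaut.iff_refl (φ : LForm Agt Atm) : LTaut (φ.iff φ) := by
  intro v _ hn ha
  simp only [LForm.iff, LForm.imp, hn, ha]
  tauto

theorem CProv.iff_trans {φ ψ χ : LForm Agt Atm} (h₁ : CProv C (φ.iff ψ))
    (h₂ : CProv C (ψ.iff χ)) : CProv C (φ.iff χ) := by
  refine .mp (.mp (.taut ?_) h₁) h₂
  intro v _ hn ha
  simp only [LForm.iff, LForm.imp, hn, ha]
  tauto

theorem CProv.neg_congr {φ ψ : LForm Agt Atm} (h : CProv C (φ.iff ψ)) :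
    CProv C (φ.neg.iff ψ.neg) := by
  refine .mp (.taut ?_) h
  intro v _ hn ha
  simp only [LForm.iff, LForm.imp, hn, ha]
  tauto

theorem CProv.and_congr {φ φ' ψ ψ' : LForm Agt Atm} (h₁ : CProv C (φ.iff φ'))
    (h₂ : CProv C (ψ.iff ψ')) : CProv C ((φ.and ψ).iff (φ'.and ψ')) := by
  refine .mp (.mp (.taut ?_) h₁) h₂
  intro v _ hn ha
  simp only [LForm.iff, LForm.imp, hn, ha]
  tauto

/-- A formula is reducible when it is provably equivalent to a reduced formula. -/
def Reducible (C : Finset Agt → Finset (Net Agt)) (φ : LForm Agt Atm) : Prop :=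
  ∃ ψ : LForm Agt Atm, Reduced ψ ∧ CProv C (φ.iff ψ)

namespace Reducible

theorem of_reduced {φ : LForm Agt Atm} (h : Reduced φ) : Reducible C φ :=
  ⟨φ, h, .taut (.iff_refl φ)⟩

theorem of_iff {φ ψ : LForm Agt Atm} (h : CProv C (φ.iff ψ)) (hψ : Reducible C ψ) :
    Reducible C φ := by
  obtain ⟨χ, hχ, h'⟩ := hψ
  exact ⟨χ, hχ, h.iff_trans h'⟩

theorem neg {φ : LForm Agt Atm} (h : Reducible C φ) : Reducible C φ.neg := by
  obtain ⟨φ', hr, h'⟩ := h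
  exact ⟨φ'.neg, hr, h'.neg_congr⟩

theorem and {φ ψ : LForm Agt Atm} (hφ : Reducible C φ) (hψ : Reducible C ψ) :
    Reducible C (φ.and ψ) := by
  obtain ⟨φ', hr, h⟩ := hφ
  obtain ⟨ψ', hr', h'⟩ := hψ
  exact ⟨φ'.and ψ', ⟨hr, hr'⟩, h.and_congr h'⟩

theorem imp {φ ψ : LForm Agt Atm} (hφ : Reducible C φ) (hψ : Reducible C ψ) :
    Reducible C (φ.imp ψ) :=
  (hφ.and hψ.neg).neg

theorem bigAnd {l : List (LForm Agt Atm)} (h : ∀ φ ∈ l, Reducible C φ) :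
    Reducible C (LForm.bigAnd l) := by
  induction l with
  | nil => exact of_reduced trivial
  | cons φ l ih =>
    exact (h φ List.mem_cons_self).and (ih fun ψ hψ => h ψ (List.mem_cons_of_mem _ hψ))

theorem bigOr {l : List (LForm Agt Atm)} (h : ∀ φ ∈ l, Reducible C φ) :
    Reducible C (LForm.bigOr l) := by
  induction l with
  | nil => exact (of_reduced (φ := .top) trivial).neg
  | cons φ l ih =>
    exact ((h φ List.mem_cons_self).neg.and
      (ih fun ψ hψ => h ψ (List.mem_cons_of_mem _ hψ)).neg).neg

end Reducible

theorem Coal.eq_single_or_two_le_card (G : Coal Agt) :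
    (∃ i, G = single i) ∨ 2 ≤ G.1.card := by
  rcases (Nat.one_le_iff_ne_zero.2 G.2.card_pos.ne').eq_or_lt with h | h
  · obtain ⟨i, hi⟩ := Finset.card_eq_one.1 h.symm
    exact .inl ⟨i, Subtype.ext hi⟩
  · exact .inr h

namespace Reducible

theorem A_single (i : Agt) {φ : LForm Agt Atm} (h : Reducible C φ) :
    Reducible C (.A (single i) φ) := by
  obtain ⟨ψ, hr, h'⟩ := h
  exact ⟨.A (single i) ψ, ⟨⟨i, rfl⟩, hr⟩, .rea i h'⟩

theorem E_single (i : Agt) {φ : LForm Agt Atm} (h : Reducible C φ) :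
    Reducible C (.E (single i) φ) := by
  obtain ⟨ψ, hr, h'⟩ := h
  exact ⟨.E (single i) ψ, ⟨⟨i, rfl⟩, hr⟩, .ree i h'⟩

theorem A (G : Coal Agt) {φ : LForm Agt Atm} (h : Reducible C φ) :
    Reducible C (.A G φ) := by
  rcases G.eq_single_or_two_le_card with ⟨i, rfl⟩ | hG
  · exact h.A_single i
  · refine of_iff (.attind G hG φ) (bigAnd fun ψ hψ => ?_)
    obtain ⟨i, -, rfl⟩ := List.mem_map.1 hψ
    exact h.A_single i

theorem E (hC : CohClass C) (G : Coal Agt) {φ : LForm Agt Atm} (h : Reducible C φ) :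
    Reducible C (.E G φ) := by
  induction hn : G.1.card using Nat.strong_induction_on generalizing G φ with
  | _ n ih =>
    subst hn
    rcases G.eq_single_or_two_le_card with ⟨i, rfl⟩ | hG
    · exact h.E_single i
    · refine of_iff (.cohagen G hG φ) (bigOr fun ψ hψ => ?_)
      obtain ⟨N, hN, rfl⟩ := List.mem_map.1 hψ
      refine bigAnd fun χ hχ => ?_
      obtain ⟨e, he, rfl⟩ := List.mem_map.1 hχ
      obtain ⟨hΓ, hedge, -⟩ := hC G.1 hG N (Finset.mem_toList.1 hN)
      obtain ⟨hsub, hne⟩ := hΓ e.1 (hedge e (Finset.mem_toList.1 he)).1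
      exact of_iff (.help_ax e.1 e.2 φ) <|
        (ih _ (Finset.card_lt_card (hsub.ssubset_of_ne hne)) e.1 ((h.A e.2).imp h) rfl).and
          (h.A e.2)

theorem help (hC : CohClass C) (C₁ C₂ : Coal Agt) {φ : LForm Agt Atm} (h : Reducible C φ) :
    Reducible C (.help C₁ C₂ φ) :=
  of_iff (.help_ax C₁ C₂ φ) (((h.A C₂).imp h).E hC C₁ |>.and (h.A C₂))

end Reducible

end Reduction

/-- For every class C of cohesion networks and every formula φ,
    there is a reduced formula ψ with ⊢_C φ ↔ ψ. -/
theorem cprov_reduction {Agt Atm : Type} [Fintype Agt] [DecidableEq Agt]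
    [Fintype Atm] [DecidableEq Atm]
    (C : Finset Agt → Finset (Net Agt)) (hC : CohClass C)
    (φ : LForm Agt Atm) :
    ∃ ψ : LForm Agt Atm, Reduced ψ ∧ CProv C (φ.iff ψ) := by
  induction φ with
  | atom p => exact Reducible.of_reduced (φ := .atom p) trivial
  | top => exact Reducible.of_reduced (φ := .top) trivial
  | neg _ ih => exact Reducible.neg ih
  | and _ _ ih₁ ih₂ => exact Reducible.and ih₁ ih₂
  | E G _ ih => exact Reducible.E hC G ih
  | A G _ ih => exact Reducible.A G ih
  | help C₁ C₂ _ ih => exact Reducible.help hC C₁ C₂ ih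
end

section
/- Let C be any class of cohesion networks and let φ ∈ L be a formula all of whose coalition modalities are of the form E_{i} or A_{i} for singleton coalitions {i} (no Help modalities and no modalities indexed by nondegenerate groups). Then ⊢_C φ if and only if ⊢_BIAT φ*, where φ* is the BIAT formula obtained from φ by replacing each modality E_{{i}} by E_i and each A_{{i}} by A_i. -/
/- `Tr φ φ'` holds exactly when φ ∈ L contains no Help modality, all its
   coalition modalities are indexed by singletons, and φ' is the BIAT formula
   φ* obtained from φ by replacing each E_{{i}} by E_i and each A_{{i}} by A_i. -/
inductive Tr {Agt Atm : Type} [DecidableEq Agt] : LForm Agt Atm → BForm Agt Atm → Prop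
  | atom (a : Atm) : Tr (LForm.atom a) (BForm.atom a)
  | top : Tr LForm.top BForm.top
  | neg {φ φ'} : Tr φ φ' → Tr (LForm.neg φ) (BForm.neg φ')
  | and {φ φ' ψ ψ'} : Tr φ φ' → Tr ψ ψ' →
      Tr (LForm.and φ ψ) (BForm.and φ' ψ')
  | E (i : Agt) {φ φ'} : Tr φ φ' → Tr (LForm.E (single i) φ) (BForm.E i φ')
  | A (i : Agt) {φ φ'} : Tr φ φ' → Tr (LForm.A (single i) φ) (BForm.A i φ')

namespace BForm

variable {Agt Atm : Type}

def bigAnd (l : List (BForm Agt Atm)) : BForm Agt Atm := l.foldr and top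

def bigOr (l : List (BForm Agt Atm)) : BForm Agt Atm :=
  l.foldr (fun φ ψ => neg (and (neg φ) (neg ψ))) (neg top)

theorem biat_iff_refl (φ : BForm Agt Atm) : BIAT (φ.iff φ) := by
  refine BIAT.taut fun v _ hneg hand => ?_
  simp only [iff, imp, hneg, hand]
  tauto

/-- The inclusion of BIAT formulas into `LForm`, indexing each modality by a singleton. -/
def toLForm [DecidableEq Agt] : BForm Agt Atm → LForm Agt Atm
  | atom a => .atom a
  | top => .top
  | neg φ => .neg φ.toLForm
  | and φ ψ => .and φ.toLForm ψ.toLForm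
  | E i φ => .E (single i) φ.toLForm
  | A i φ => .A (single i) φ.toLForm

end BForm

section Coalitions

variable {Agt Atm : Type} [DecidableEq Agt]

/-- The attempt of a coalition, as the conjunction of the attempts of its members. -/
noncomputable def coalA (G : Coal Agt) (φ : BForm Agt Atm) : BForm Agt Atm :=
  if 2 ≤ G.1.card then BForm.bigAnd (G.1.toList.map fun i => BForm.A i φ)
  else BForm.A G.2.choose φ

/-- The agency of a coalition, unfolded along the cohesion networks in `C`. The size test on edges
ensures termination; it always succeeds for a class of cohesion networks. -/
noncomputable def coalE (C : Finset Agt → Finset (Net Agt)) (G : Coal Agt) (φ : BForm Agt Atm) :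
    BForm Agt Atm :=
  if 2 ≤ G.1.card then
    BForm.bigOr ((C G.1).toList.map fun N => BForm.bigAnd (N.2.toList.map fun e =>
      if _h : e.1.1.card < G.1.card then
        (coalE C e.1 ((coalA e.2 φ).imp φ)).and (coalA e.2 φ)
      else BForm.top))
  else BForm.E G.2.choose φ
termination_by G.1.card

theorem single_choose (i : Agt) : (single i).2.choose = i :=
  Finset.mem_singleton.1 (single i).2.choose_spec

theorem coalA_single (i : Agt) (φ : BForm Agt Atm) : coalA (single i) φ = BForm.A i φ := by
  rw [coalA, if_neg (by simp [single]), single_choose]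

theorem coalE_single (C : Finset Agt → Finset (Net Agt)) (i : Agt) (φ : BForm Agt Atm) :
    coalE C (single i) φ = BForm.E i φ := by
  rw [coalE, if_neg (by simp [single]), single_choose]

theorem Admissible.card_lt {G : Finset Agt} {N : Net Agt} (hN : Admissible G N)
    {e : Coal Agt × Coal Agt} (he : e ∈ N.2) : e.1.1.card < G.card :=
  Finset.card_lt_card ((hN.1 _ (hN.2.1 e he).1).1.ssubset_of_ne (hN.1 _ (hN.2.1 e he).1).2)

theorem coalE_of_two_le_card {C : Finset Agt → Finset (Net Agt)} (hC : CohClass C) {G : Coal Agt}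
    (hG : 2 ≤ G.1.card) (φ : BForm Agt Atm) :
    coalE C G φ = BForm.bigOr ((C G.1).toList.map fun N => BForm.bigAnd (N.2.toList.map fun e =>
      (coalE C e.1 ((coalA e.2 φ).imp φ)).and (coalA e.2 φ))) := by
  rw [coalE, if_pos hG]
  congr 1
  refine List.map_congr_left fun N hN => ?_
  congr 1
  refine List.map_congr_left fun e he => ?_
  exact dif_pos ((hC _ hG N (Finset.mem_toList.1 hN)).card_lt (Finset.mem_toList.1 he))

namespace LForm

/-- The reduction of `LForm` to BIAT formulas that eliminates `Help` and group modalities. -/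
noncomputable def toBForm (C : Finset Agt → Finset (Net Agt)) : LForm Agt Atm → BForm Agt Atm
  | atom a => .atom a
  | top => .top
  | neg φ => .neg (φ.toBForm C)
  | and φ ψ => .and (φ.toBForm C) (ψ.toBForm C)
  | E G φ => coalE C G (φ.toBForm C)
  | A G φ => coalA G (φ.toBForm C)
  | help G H φ =>
    (coalE C G ((coalA H (φ.toBForm C)).imp (φ.toBForm C))).and (coalA H (φ.toBForm C))

theorem toBForm_iff (C : Finset Agt → Finset (Net Agt)) (φ ψ : LForm Agt Atm) :
    (φ.iff ψ).toBForm C = (φ.toBForm C).iff (ψ.toBForm C) := rfl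

theorem toBForm_bigAnd (C : Finset Agt → Finset (Net Agt)) (l : List (LForm Agt Atm)) :
    (bigAnd l).toBForm C = BForm.bigAnd (l.map (toBForm C)) := by
  induction l with
  | nil => rfl
  | cons φ l ih => exact congrArg (BForm.and (φ.toBForm C)) ih

theorem toBForm_bigOr (C : Finset Agt → Finset (Net Agt)) (l : List (LForm Agt Atm)) :
    (bigOr l).toBForm C = BForm.bigOr (l.map (toBForm C)) := by
  induction l with
  | nil => rfl
  | cons φ l ih =>
    exact congrArg (fun ψ => BForm.neg (.and (.neg (φ.toBForm C)) (.neg ψ))) ih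

end LForm

theorem CProv.biat_toBForm {C : Finset Agt → Finset (Net Agt)} (hC : CohClass C)
    {φ : LForm Agt Atm} (h : CProv C φ) : BIAT (φ.toBForm C) := by
  induction h with
  | taut h =>
    exact .taut fun v htop hneg hand =>
      h (fun ψ => v (ψ.toBForm C)) htop (fun _ => hneg _) (fun _ _ => hand _ _)
  | notaut i =>
    simpa only [LForm.toBForm, coalE_single] using BIAT.notaut i
  | success i φ =>
    simpa only [LForm.toBForm, LForm.imp, BForm.imp, coalE_single] using BIAT.success i (φ.toBForm C)
  | help_ax G H φ => exact BForm.biat_iff_refl _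
  | cohagen G hG φ =>
    rw [LForm.toBForm_iff, LForm.toBForm_bigOr, List.map_map]
    simp only [Function.comp_def, LForm.toBForm_bigAnd, List.map_map, LForm.toBForm,
      coalE_of_two_le_card hC hG]
    exact BForm.biat_iff_refl _
  | attind G hG φ =>
    rw [LForm.toBForm_iff, LForm.toBForm_bigAnd, List.map_map]
    simp only [Function.comp_def, LForm.toBForm, coalA_single]
    rw [coalA, if_pos hG]
    exact BForm.biat_iff_refl _
  | mp _ _ ih₁ ih₂ => exact .mp ih₁ ih₂
  | ree i _ ih =>
    simpa only [LForm.toBForm_iff, LForm.toBForm, coalE_single] using BIAT.ree i ih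
  | rea i _ ih =>
    simpa only [LForm.toBForm_iff, LForm.toBForm, coalA_single] using BIAT.rea i ih

theorem BIAT.cprov_toLForm (C : Finset Agt → Finset (Net Agt)) {φ : BForm Agt Atm}
    (h : BIAT φ) : CProv C φ.toLForm := by
  induction h with
  | taut h =>
    exact .taut fun v htop hneg hand =>
      h (fun ψ => v ψ.toLForm) htop (fun _ => hneg _) (fun _ _ => hand _ _)
  | notaut i => exact .notaut i
  | success i φ => exact .success i φ.toLForm
  | mp _ _ ih₁ ih₂ => exact .mp ih₁ ih₂
  | ree i _ ih => exact .ree i ih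
  | rea i _ ih => exact .rea i ih

theorem Tr.toLForm_eq {φ : LForm Agt Atm} {φ' : BForm Agt Atm} (h : Tr φ φ') :
    φ'.toLForm = φ := by
  induction h <;> simp_all [BForm.toLForm]

theorem Tr.toBForm_eq (C : Finset Agt → Finset (Net Agt)) {φ : LForm Agt Atm}
    {φ' : BForm Agt Atm} (h : Tr φ φ') : φ.toBForm C = φ' := by
  induction h <;> simp_all [LForm.toBForm, coalE_single, coalA_single]

end Coalitions

/-- For every class C of cohesion networks and every formula
    φ ∈ L whose coalition modalities are all singleton-indexed (no Help
    modalities), ⊢_C φ iff ⊢_BIAT φ*, where φ* is the BIAT translation of φ. -/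
theorem cprov_iff_biat {Agt Atm : Type} [Fintype Agt] [DecidableEq Agt]
    (C : Finset Agt → Finset (Net Agt)) (hC : CohClass C)
    (φ : LForm Agt Atm) (φ' : BForm Agt Atm) (h : Tr φ φ') :
    CProv C φ ↔ BIAT φ' :=
  ⟨fun hφ => h.toBForm_eq C ▸ hφ.biat_toBForm hC, fun hφ => h.toLForm_eq ▸ hφ.cprov_toLForm C⟩
end

section
/- For every class C of cohesion networks, every nonempty group G ⊆ Agt, and every formula φ ∈ L, the formula E_Gφ → φ is provable in ⊢_C (the success property generalises from individual to group agency). -/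
namespace CProv

variable {Agt Atm : Type} [DecidableEq Agt] {C : Finset Agt → Finset (Net Agt)}
  {φ ψ χ : LForm Agt Atm}

theorem of_taut_imp (h : LTaut (φ.imp ψ)) (hφ : CProv C φ) : CProv C ψ :=
  mp (taut h) hφ

theorem of_taut_imp_imp (h : LTaut (φ.imp (ψ.imp χ))) (hφ : CProv C φ) (hψ : CProv C ψ) :
    CProv C χ :=
  mp (of_taut_imp h hφ) hψ

theorem imp_trans (h₁ : CProv C (φ.imp ψ)) (h₂ : CProv C (ψ.imp χ)) : CProv C (φ.imp χ) := by
  refine of_taut_imp_imp (fun v _ hn ha => ?_) h₁ h₂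
  simp only [LForm.imp, hn, ha]
  tauto

theorem iff_mp (h : CProv C (φ.iff ψ)) : CProv C (φ.imp ψ) := by
  refine of_taut_imp (fun v _ hn ha => ?_) h
  simp only [LForm.iff, LForm.imp, hn, ha]
  tauto

theorem or_imp (h₁ : CProv C (φ.imp χ)) (h₂ : CProv C (ψ.imp χ)) :
    CProv C ((φ.or ψ).imp χ) := by
  refine of_taut_imp_imp (fun v _ hn ha => ?_) h₁ h₂
  simp only [LForm.or, LForm.imp, hn, ha]
  tauto

theorem bigOr_imp {l : List (LForm Agt Atm)} (h : ∀ ψ ∈ l, CProv C (ψ.imp φ)) :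
    CProv C ((LForm.bigOr l).imp φ) := by
  induction l with
  | nil =>
    refine taut fun v ht hn ha => ?_
    simp [LForm.bigOr, LForm.bot, LForm.imp, hn, ha, ht]
  | cons ψ l ih =>
    exact or_imp (h ψ List.mem_cons_self) (ih fun χ hχ => h χ (List.mem_cons_of_mem ψ hχ))

theorem bigAnd_imp {l : List (LForm Agt Atm)} (h : φ ∈ l) :
    CProv C ((LForm.bigAnd l).imp φ) := by
  induction l with
  | nil => simp at h
  | cons ψ l ih =>
    rcases List.mem_cons.1 h with rfl | h
    · refine taut fun v _ hn ha => ?_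
      simp only [LForm.bigAnd, List.foldr_cons, LForm.imp, hn, ha]
      tauto
    · refine imp_trans (taut fun v _ hn ha => ?_) (ih h)
      simp only [LForm.bigAnd, List.foldr_cons, LForm.imp, hn, ha]
      tauto

/-- Success of the helping coalition's agency yields success of the help itself. -/
theorem help_imp (C₁ C₂ : Coal Agt)
    (h : CProv C ((LForm.E C₁ ((LForm.A C₂ φ).imp φ)).imp ((LForm.A C₂ φ).imp φ))) :
    CProv C ((LForm.help C₁ C₂ φ).imp φ) := by
  refine imp_trans (iff_mp (help_ax C₁ C₂ φ)) (of_taut_imp (fun v _ hn ha => ?_) h)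
  simp only [LForm.imp, hn, ha]
  tauto

end CProv

/-- For every class C of cohesion networks, every nonempty group
    G and every formula φ, ⊢_C E_Gφ → φ. -/
theorem cprov_group_success {Agt Atm : Type} [Fintype Agt] [DecidableEq Agt]
    (C : Finset Agt → Finset (Net Agt)) (hC : CohClass C)
    (G : Coal Agt) (φ : LForm Agt Atm) :
    CProv C ((LForm.E G φ).imp φ) := by
  obtain ⟨n, hn⟩ : ∃ n, G.1.card = n := ⟨_, rfl⟩
  induction n using Nat.strong_induction_on generalizing G φ with
  | _ n ih =>
    subst hn
    by_cases hG : 2 ≤ G.1.card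
    · refine (CProv.cohagen G hG φ).iff_mp.imp_trans (CProv.bigOr_imp fun ψ hψ => ?_)
      obtain ⟨N, hN, rfl⟩ := List.mem_map.1 hψ
      obtain ⟨hsub, hedge, hcover⟩ := hC G.1 hG N (Finset.mem_toList.1 hN)
      obtain ⟨i, hi⟩ := G.2
      obtain ⟨e, he, -⟩ := hcover i hi
      refine (CProv.bigAnd_imp (List.mem_map.2 ⟨e, Finset.mem_toList.2 he, rfl⟩)).imp_trans
        (CProv.help_imp e.1 e.2 (ih _ ?_ e.1 _ rfl))
      exact Finset.card_lt_card (Finset.ssubset_iff_subset_ne.2 (hsub e.1 (hedge e he).1))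
    · have hcard : G.1.card = 1 := by
        have := G.2.card_pos
        omega
      obtain ⟨i, hi⟩ := Finset.card_eq_one.1 hcard
      obtain rfl : G = single i := Subtype.ext hi
      exact CProv.success i φ
end

section
/- For every class C of cohesion networks and every nonempty group G ⊆ Agt, the formula ¬E_G⊤ is provable in ⊢_C (no group brings about a tautology; the notaut property generalises from individual to group agency). -/
namespace LForm

variable {Agt Atm : Type} [DecidableEq Agt]

/-- A Boolean valuation: modal formulas are treated as atoms. -/
structure IsValuation (v : LForm Agt Atm → Prop) : Prop where
  top : v LForm.top
  neg : ∀ ψ, v (LForm.neg ψ) ↔ ¬ v ψ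
  and : ∀ ψ χ, v (LForm.and ψ χ) ↔ (v ψ ∧ v χ)

namespace IsValuation

variable {v : LForm Agt Atm → Prop}

theorem imp (hv : IsValuation v) (φ ψ : LForm Agt Atm) : v (φ.imp ψ) ↔ (v φ → v ψ) := by
  simp [LForm.imp, hv.neg, hv.and]

theorem iff (hv : IsValuation v) (φ ψ : LForm Agt Atm) : v (φ.iff ψ) ↔ (v φ ↔ v ψ) := by
  simp [LForm.iff, hv.and, hv.imp, iff_def]

theorem or (hv : IsValuation v) (φ ψ : LForm Agt Atm) : v (φ.or ψ) ↔ (v φ ∨ v ψ) := by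
  simp only [LForm.or, hv.neg, hv.and]
  tauto

theorem bot (hv : IsValuation v) : ¬ v LForm.bot := by
  simp [LForm.bot, hv.neg, hv.top]

theorem of_bigAnd (hv : IsValuation v) {l : List (LForm Agt Atm)} (h : v (bigAnd l)) :
    ∀ φ ∈ l, v φ := by
  induction l with
  | nil => simp
  | cons ψ l ih =>
    obtain ⟨hψ, hl⟩ := (hv.and ψ (bigAnd l)).1 h
    simpa using ⟨hψ, ih hl⟩

end IsValuation

end LForm

namespace CProv

open LForm

variable {Agt Atm : Type} [DecidableEq Agt] {C : Finset Agt → Finset (Net Agt)}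
  {φ ψ χ : LForm Agt Atm}

theorem of_valid (h : ∀ v, IsValuation v → v φ) : CProv C φ :=
  taut fun v h₁ h₂ h₃ => h v ⟨h₁, h₂, h₃⟩

theorem of_entails (hφ : CProv C φ) (h : ∀ v, IsValuation v → v φ → v ψ) : CProv C ψ :=
  mp (of_valid fun v hv => (hv.imp φ ψ).2 (h v hv)) hφ

theorem of_entails₂ (hφ : CProv C φ) (hψ : CProv C ψ)
    (h : ∀ v, IsValuation v → v φ → v ψ → v χ) : CProv C χ :=
  mp (of_entails hφ fun v hv h' => (hv.imp ψ χ).2 (h v hv h')) hψ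

theorem neg_bigOr {l : List (LForm Agt Atm)} (h : ∀ φ ∈ l, CProv C φ.neg) :
    CProv C (bigOr l).neg := by
  induction l with
  | nil => exact of_valid fun v hv => (hv.neg _).2 hv.bot
  | cons ψ l ih =>
    rw [List.forall_mem_cons] at h
    refine of_entails₂ h.1 (ih h.2) fun v hv h₁ h₂ => (hv.neg _).2 fun h₃ => ?_
    exact ((hv.or ψ (bigOr l)).1 h₃).elim ((hv.neg _).1 h₁) ((hv.neg _).1 h₂)

theorem neg_bigAnd {l : List (LForm Agt Atm)} (hφ : φ ∈ l) (h : CProv C φ.neg) :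
    CProv C (bigAnd l).neg :=
  of_entails h fun _ hv h₁ => (hv.neg _).2 fun h₂ => (hv.neg _).1 h₁ (hv.of_bigAnd h₂ φ hφ)

theorem neg_of_iff (h : CProv C (φ.iff ψ)) (hψ : CProv C ψ.neg) : CProv C φ.neg :=
  of_entails₂ h hψ fun _ hv h₁ h₂ =>
    (hv.neg _).2 fun h₃ => (hv.neg _).1 h₂ (((hv.iff _ _).1 h₁).1 h₃)

/-- No individual brings about a theorem. -/
theorem neg_E_single (i : Agt) (hφ : CProv C φ) : CProv C (E (single i) φ).neg :=
  neg_of_iff (ree i (of_entails hφ fun _ hv h => (hv.iff φ top).2 (iff_of_true h hv.top)))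
    (notaut i)

theorem neg_help {C₁ C₂ : Coal Agt} (h : CProv C (E C₁ ((A C₂ φ).imp φ)).neg) :
    CProv C (help C₁ C₂ φ).neg :=
  neg_of_iff (help_ax C₁ C₂ φ) <| of_entails h fun _ hv h₁ =>
    (hv.neg _).2 fun h₂ => (hv.neg _).1 h₁ ((hv.and _ _).1 h₂).1

/-- No group brings about a theorem. -/
theorem neg_E (hC : CohClass C) (G : Coal Agt) (hφ : CProv C φ) : CProv C (E G φ).neg := by
  induction hn : G.1.card using Nat.strong_induction_on generalizing G φ with
  | _ n ih =>
    subst hn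
    by_cases hG : 2 ≤ G.1.card
    · refine neg_of_iff (cohagen G hG φ) (neg_bigOr ?_)
      simp only [List.mem_map, Finset.mem_toList, forall_exists_index, and_imp]
      rintro _ N hN rfl
      obtain ⟨hΓ, hedge, hcover⟩ := hC G.1 hG N hN
      obtain ⟨i, hi⟩ := G.2
      obtain ⟨e, he, -⟩ := hcover i hi
      obtain ⟨hsub, hne⟩ := hΓ e.1 (hedge e he).1
      refine neg_bigAnd (List.mem_map_of_mem (Finset.mem_toList.2 he)) (neg_help ?_)
      exact ih _ (Finset.card_lt_card (hsub.ssubset_of_ne hne)) e.1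
        (of_entails hφ fun _ hv h => (hv.imp _ _).2 fun _ => h) rfl
    · obtain ⟨i, hi⟩ := Finset.card_eq_one.1
        (le_antisymm (by omega) (Finset.card_pos.2 G.2))
      obtain rfl : G = single i := Subtype.ext hi
      exact neg_E_single i hφ

end CProv

/-- For every class C of cohesion networks and every nonempty
    group G, ⊢_C ¬E_G⊤. -/
theorem cprov_group_notaut {Agt Atm : Type} [Fintype Agt] [DecidableEq Agt]
    (C : Finset Agt → Finset (Net Agt)) (hC : CohClass C)
    (G : Coal Agt) :
    CProv C (LForm.neg (LForm.E G (LForm.top : LForm Agt Atm))) := by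
  exact CProv.neg_E hC G (CProv.of_valid fun _ hv => hv.top)
end
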